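/- arXiv:2309.11902 — 2 statements merged into one kernel-verified Lean document; each statement's English description precedes it below -/
import Mathlib

section
/- Let P_i, P_j be positive integers, O_i, O_j integers, and C_i, C_j positive integers. Suppose the transmission intervals of the two flows are pairwise disjoint, i.e., for all k, l ∈ ℤ the half-open intervals [k·P_i + O_i, k·P_i + O_i + C_i) and [l·P_j + O_j, l·P_j + O_j + C_j) are disjoint. Then every element d of the gap set D_ij = { d ∈ ℤ | d ≥ 0 and d = (k·P_i + O_i) − (l·P_j + O_j) for some k, l ∈ ℤ } satisfies d ≥ C_j; in particular the least element g_ij of D_ij satisfies g_ij − C_j ≥ 0. -/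
/-- Conflict-freedom of two time-triggered flows (disjoint transmission
intervals) implies that every element of the gap set is at least the
transmission time `C_j`; in particular the minimum gap satisfies
`g_ij - C_j ≥ 0`. -/
theorem conflict_free_gap_ge_transmission_time
    (Pi Pj : ℤ) (hPi : 0 < Pi) (hPj : 0 < Pj) (Oi Oj : ℤ)
    (Ci Cj : ℤ) (hCi : 0 < Ci) (hCj : 0 < Cj)
    (hdisj : ∀ k l : ℤ,
      Disjoint (Set.Ico (k * Pi + Oi) (k * Pi + Oi + Ci))
               (Set.Ico (l * Pj + Oj) (l * Pj + Oj + Cj))) :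
    (∀ d ∈ {d : ℤ | 0 ≤ d ∧ ∃ k l : ℤ, d = (k * Pi + Oi) - (l * Pj + Oj)}, Cj ≤ d) ∧
    (∀ g : ℤ, IsLeast {d : ℤ | 0 ≤ d ∧ ∃ k l : ℤ, d = (k * Pi + Oi) - (l * Pj + Oj)} g →
        0 ≤ g - Cj) := by
  have gap_ge : ∀ d ∈ {d : ℤ | 0 ≤ d ∧ ∃ k l : ℤ, d = (k * Pi + Oi) - (l * Pj + Oj)},
      Cj ≤ d := by
    rintro d ⟨hd, k, l, rfl⟩
    by_contra! hlt
    exact Set.disjoint_left.mp (hdisj k l)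
      (Set.left_mem_Ico.mpr (by linarith)) ⟨by linarith, by linarith⟩
  exact ⟨gap_ge, fun g hg => sub_nonneg.mpr (gap_ge g hg.1)⟩
end

section
/- (Safe Jitter Range.) Let N ≥ 1 flows be given, flow i having positive integer period P_i, integer offset O_i, positive integer transmission time C_i, and integer configured jitter J_i ≥ 0. For i ≠ j let g_ij be the least element of D_ij = { d ∈ ℤ | d ≥ 0 and d = (k·P_i + O_i) − (l·P_j + O_j) for some k, l ∈ ℤ }, and let g_ii be the least element of { d ∈ ℤ | d ≥ 0 and d = (k − l)·P_i for some k ≠ l }. Assume that for all i, j: J_i ≤ g_ij − C_j. Then for all pairs (i, k) ≠ (j, l) (i, j flow indices, k, l ∈ ℤ), the half-open intervals [k·P_i + O_i − J_i, k·P_i + O_i + C_i) and [l·P_j + O_j − J_j, l·P_j + O_j + C_j) are disjoint; i.e., under the safe jitter configuration, held copies have no transmission conflicts with TT frames or with other held copies. -/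
/-- Theorem 1 (Safe Jitter Range) of the paper: if each configured jitter
`J_i` satisfies `0 ≤ J_i ≤ g_ij - C_j` for every `j`, then the transmission
envelopes `[k·P_i + O_i - J_i, k·P_i + O_i + C_i)` of distinct frames (held
copies together with their TT frames) are pairwise disjoint, i.e., there are
no transmission conflicts. -/
theorem safe_jitter_range_no_conflict
    (N : ℕ) (hN : 0 < N)
    (P O C J : Fin N → ℤ) (g : Fin N → Fin N → ℤ)
    (hP : ∀ i, 0 < P i) (hC : ∀ i, 0 < C i) (hJ0 : ∀ i, 0 ≤ J i)
    (hg : ∀ i j, i ≠ j →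
      IsLeast {d : ℤ | 0 ≤ d ∧ ∃ k l : ℤ, d = (k * P i + O i) - (l * P j + O j)} (g i j))
    (hgii : ∀ i,
      IsLeast {d : ℤ | 0 ≤ d ∧ ∃ k l : ℤ, k ≠ l ∧ d = (k - l) * P i} (g i i))
    (hJ : ∀ i j, J i ≤ g i j - C j) :
    ∀ (i j : Fin N) (k l : ℤ), (i, k) ≠ (j, l) →
      Disjoint (Set.Ico (k * P i + O i - J i) (k * P i + O i + C i))
               (Set.Ico (l * P j + O j - J j) (l * P j + O j + C j)) := by
  have sep : ∀ (i j : Fin N) (k l : ℤ), (i, k) ≠ (j, l) →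
      l * P j + O j ≤ k * P i + O i →
      l * P j + O j + C j ≤ k * P i + O i - J i := by
    intro i j k l hne hle
    have hgap : g i j ≤ (k * P i + O i) - (l * P j + O j) := by
      by_cases hij : i = j
      · subst hij
        have hkl : k ≠ l := fun h => hne (by rw [h])
        exact (hgii i).2 ⟨by linarith, k, l, hkl, by ring⟩
      · exact (hg i j hij).2 ⟨by linarith, k, l, rfl⟩
    linarith [hJ i j]
  intro i j k l hne
  rw [Set.disjoint_left]
  rintro x ⟨hx₁, hx₂⟩ ⟨hx₃, hx₄⟩
  rcases le_total (l * P j + O j) (k * P i + O i) with h | h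
  · linarith [sep i j k l hne h]
  · linarith [sep j i l k hne.symm h]
end
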